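/- arXiv:math/0409464 — 4 statements merged into one kernel-verified Lean document; each statement's English description precedes it below -/
import Mathlib

section
/- Let N ≥ 1, let a, u : [-1,1] → ℂ be continuous, and let y_0 ∈ ℂ. Suppose y : [-1,1] → ℂ is differentiable with y'(t) = a(t)·y(t) + u(t) for all t ∈ [-1,1] and y(−1) = y_0. Suppose p is a polynomial of degree ≤ N satisfying p'(t_j) = a(t_j)·p(t_j) + u(t_j) for j = 0,…,N−1 and p(−1) = y_0. Set R_p = p'(−1) − a(−1)·y_0 − u(−1). Then ‖y − p‖_∞ ≤ 2·C_a·( ‖a·p − I_N(a·p)‖_∞ + ‖u − I_N(u)‖_∞ + |R_p| ). -/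
open Set Polynomial

/-- The Chebyshev collocation points `t_j = cos(jπ/N)`. -/
noncomputable def chebNode (N j : ℕ) : ℝ := Real.cos (j * Real.pi / N)

/-- The uniform (sup) norm of a function over `[-1,1]`. -/
noncomputable def supNorm (f : ℝ → ℂ) : ℝ := ⨆ t : Set.Icc (-1 : ℝ) 1, ‖f t‖

lemma aux_U_bound (n : ℕ) (x : ℝ) (hx : x ∈ Icc (-1 : ℝ) 1) :
    |(Chebyshev.U ℝ n).eval x| ≤ n + 1 := by
  have hxa : |x| ≤ 1 := abs_le.2 hx
  induction n with
  | zero => simp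
  | succ n ih =>
    have h := Chebyshev.U_eq_X_mul_U_add_T ℝ n
    have hT : |(Chebyshev.T ℝ ((n : ℤ) + 1)).eval x| ≤ 1 :=
      Chebyshev.abs_eval_T_real_le_one _ hxa
    push_cast
    rw [h, eval_add, eval_mul, eval_X]
    calc _ ≤ |x * (Chebyshev.U ℝ n).eval x| + |(Chebyshev.T ℝ ((n : ℤ) + 1)).eval x| :=
          abs_add_le _ _
      _ ≤ 1 * (n + 1) + 1 := by
          rw [abs_mul]; gcongr
      _ = _ := by ring

lemma aux_U_cast (n : ℕ) (x : ℝ) :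
    (Chebyshev.U ℂ n).eval (x : ℂ) = (((Chebyshev.U ℝ n).eval x : ℝ) : ℂ) := by
  rw [← Chebyshev.map_U Complex.ofRealHom, eval_map]
  exact eval₂_at_apply Complex.ofRealHom x

lemma aux_node_inj (N : ℕ) (hN : 1 ≤ N) :
    Set.InjOn (fun j : ℕ => ((chebNode N j : ℝ) : ℂ)) (Finset.range (N + 1) : Finset ℕ) := by
  intro i hi j hj h
  simp only [Finset.coe_range, Set.mem_Iio] at hi hj
  have hN0 : (0 : ℝ) < N := by exact_mod_cast hN
  have h' : chebNode N i = chebNode N j := Complex.ofReal_injective h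
  have hm : ∀ k : ℕ, k < N + 1 → (k * Real.pi / N : ℝ) ∈ Icc 0 Real.pi := by
    intro k hk
    have : (k : ℝ) ≤ N := by exact_mod_cast Nat.lt_succ_iff.1 hk
    refine ⟨by positivity, ?_⟩
    rw [div_le_iff₀ hN0]
    nlinarith [Real.pi_pos]
  have := Real.injOn_cos (hm i hi) (hm j hj) h'
  have hpi := Real.pi_pos
  field_simp at this
  exact_mod_cast this

lemma aux_r (M : ℕ) (r : ℂ[X]) (hr : r.natDegree ≤ M + 1)
    (h0 : ∀ j < M + 1, r.eval ((chebNode (M + 1) j : ℝ) : ℂ) = 0)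
    (x : ℝ) (hx : x ∈ Icc (-1 : ℝ) 1) :
    ‖r.eval (x : ℂ)‖ ≤ ‖r.eval ((-1 : ℝ) : ℂ)‖ := by
  set R := r.eval ((-1 : ℝ) : ℂ) with hR
  have hM : ((M : ℂ) + 1) ≠ 0 := by exact_mod_cast Nat.succ_ne_zero M
  have hCm : ∀ (c : ℂ) (f : ℂ[X]), (C c * f).degree ≤ f.degree := fun c f => by
    refine (degree_mul_le _ _).trans ?_
    calc _ ≤ 0 + f.degree := add_le_add degree_C_le le_rfl
      _ = _ := zero_add _
  have key : C (2 * ((M : ℂ) + 1)) * r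
      = C (R * (-1) ^ M) * ((1 - X) * Chebyshev.U ℂ M) := by
    apply Polynomial.eq_of_degrees_lt_of_eval_index_eq (s := Finset.range (M + 1 + 1))
      (v := fun j : ℕ => ((chebNode (M + 1) j : ℝ) : ℂ)) (aux_node_inj (M + 1) (by omega))
    · rw [Finset.card_range]
      refine lt_of_le_of_lt (hCm _ _) ?_
      refine lt_of_le_of_lt degree_le_natDegree ?_
      exact_mod_cast Nat.lt_succ_of_le hr
    · rw [Finset.card_range]
      refine lt_of_le_of_lt (hCm _ _) ?_
      have h1 : ((1 : ℂ[X]) - X).degree ≤ 1 :=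
        (degree_sub_le _ _).trans (by simp)
      refine lt_of_le_of_lt ((degree_mul_le _ _).trans (add_le_add h1
        (Chebyshev.degree_U_natCast ℂ M).le)) ?_
      norm_cast
      omega
    · intro j hj
      rw [Finset.mem_range] at hj
      by_cases hjM : j < M + 1
      · simp only [eval_mul, eval_C, h0 j hjM, mul_zero]
        rcases Nat.eq_zero_or_pos j with rfl | hj0
        · simp [chebNode]
        · have hs := Chebyshev.U_real_cos (j * Real.pi / (M + 1 : ℕ)) M
          have hz : ((M : ℤ) + 1 : ℝ) * (j * Real.pi / (M + 1 : ℕ)) = j * Real.pi := by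
            push_cast; field_simp
          rw [hz, Real.sin_nat_mul_pi] at hs
          have hpos : 0 < Real.sin (j * Real.pi / (M + 1 : ℕ)) := by
            have : (0 : ℝ) < j := by exact_mod_cast hj0
            apply Real.sin_pos_of_pos_of_lt_pi
            · positivity
            · rw [div_lt_iff₀ (by positivity)]
              have : (j : ℝ) < (M + 1 : ℕ) := by exact_mod_cast hjM
              nlinarith [Real.pi_pos]
          have hU : (Chebyshev.U ℝ M).eval (chebNode (M + 1) j) = 0 := by
            rcases mul_eq_zero.1 hs with h | h
            · exact h
            · exact absurd h hpos.ne'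
          rw [aux_U_cast, hU]; simp
      · have : j = M + 1 := by omega
        subst this
        have hn : chebNode (M + 1) (M + 1) = -1 := by
          unfold chebNode
          rw [mul_div_assoc, mul_div_cancel₀ _ (by positivity), Real.cos_pi]
        rw [hn]
        simp only [eval_mul, eval_C, ← hR]
        have hU := Chebyshev.U_eval_neg_one (R := ℂ) M
        push_cast
        rw [hU]
        have hsq : ((-1 : ℂ) ^ M) * (-1) ^ M = 1 := by
          rw [← mul_pow]; simp
        have hneg : (((M : ℤ).negOnePow : ℤ) : ℂ) = (-1) ^ M := by
          rw [Int.negOnePow_def]; simp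
        simp only [eval_sub, eval_one, eval_X]
        rw [hneg]
        push_cast
        linear_combination (-R * 2 * (M + 1)) * hsq
  have hk := congrArg (fun f => ‖f.eval (x : ℂ)‖) key
  have hUb := aux_U_bound M x hx
  simp only [eval_mul, eval_C, eval_sub, eval_one, eval_X, norm_mul, norm_pow, norm_neg,
    norm_one, one_pow, mul_one, aux_U_cast, Complex.norm_real, Real.norm_eq_abs] at hk
  have e1 : ‖(1 : ℂ) - x‖ ≤ 2 := by
    rw [← Complex.ofReal_one, ← Complex.ofReal_sub, Complex.norm_real, Real.norm_eq_abs, abs_le]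
    constructor <;> linarith [hx.1, hx.2]
  have e2 : ‖(M : ℂ) + 1‖ = M + 1 := by
    have : ((M : ℂ) + 1) = ((M + 1 : ℕ) : ℂ) := by push_cast; rfl
    rw [this, Complex.norm_natCast]; push_cast; rfl
  rw [e2] at hk
  have e3 : ‖(2 : ℂ)‖ = 2 := by simp
  rw [e3] at hk
  have hb : ‖(1 : ℂ) - x‖ * |(Chebyshev.U ℝ M).eval x| ≤ 2 * (M + 1) := by gcongr
  have hb2 := mul_le_mul_of_nonneg_left hb (norm_nonneg R)
  rw [← hk] at hb2
  have hp : (0 : ℝ) < 2 * (M + 1) := by positivity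
  nlinarith

lemma aux_sup (f : ℝ → ℂ) (hf : ContinuousOn f (Icc (-1 : ℝ) 1)) (t : ℝ)
    (ht : t ∈ Icc (-1 : ℝ) 1) : ‖f t‖ ≤ supNorm f := by
  unfold _root_.supNorm
  obtain ⟨B, hB⟩ := isCompact_Icc.exists_bound_of_continuousOn hf
  exact le_ciSup (f := fun t : Set.Icc (-1 : ℝ) 1 => ‖f t‖)
    ⟨B, by rintro _ ⟨s, rfl⟩; exact hB s s.2⟩ ⟨t, ht⟩

lemma aux_gronwall (a e g : ℝ → ℂ) (ha : ContinuousOn a (Icc (-1 : ℝ) 1)) (G : ℝ)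
    (he : ∀ t ∈ Icc (-1 : ℝ) 1, HasDerivWithinAt e (a t * e t + g t) (Icc (-1 : ℝ) 1) t)
    (he0 : e (-1) = 0) (hg : ∀ t ∈ Icc (-1 : ℝ) 1, ‖g t‖ ≤ G)
    (t : ℝ) (ht : t ∈ Icc (-1 : ℝ) 1) :
    ‖e t‖ ≤ 2 * Real.exp (∫ s in (-1 : ℝ)..1, max (a s).re 0) * G := by
  have h11 : (-1 : ℝ) ≤ 1 := by norm_num
  have hG : 0 ≤ G := (norm_nonneg _).trans (hg t ht)
  set A : ℝ → ℂ := IccExtend h11 ((Icc (-1 : ℝ) 1).domRestrict a) with hA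
  have hAc : Continuous A := (continuousOn_iff_continuous_domRestrict.1 ha).Icc_extend'
  have hAa : ∀ s ∈ Icc (-1 : ℝ) 1, A s = a s := fun s hs => by
    rw [hA, IccExtend_of_mem h11 _ hs]; rfl
  have hI : (∫ s in (-1 : ℝ)..1, max (a s).re 0) = ∫ s in (-1 : ℝ)..1, max (A s).re 0 := by
    apply intervalIntegral.integral_congr
    intro s hs
    rw [uIcc_of_le h11] at hs
    simp only [hAa s hs]
  rw [hI]
  have hmc : Continuous fun s => max (A s).re 0 :=
    (Complex.continuous_re.comp hAc).max continuous_const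
  set F : ℝ → ℂ := fun s => ∫ x in (-1 : ℝ)..s, A x with hF
  have hFd : ∀ s, HasDerivAt F (A s) s := fun s =>
    intervalIntegral.integral_hasDerivAt_right (hAc.intervalIntegrable _ _)
      (hAc.stronglyMeasurableAtFilter _ _) hAc.continuousAt
  have hsub : Icc (-1 : ℝ) t ⊆ Icc (-1 : ℝ) 1 := Icc_subset_Icc_right ht.2
  have hh : ∀ s ∈ Icc (-1 : ℝ) t, HasDerivWithinAt
      (fun s => Complex.exp (F t - F s) * e s) (Complex.exp (F t - F s) * g s)
      (Icc (-1 : ℝ) t) s := by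
    intro s hs
    have h1 := (((hFd s).const_sub (F t)).cexp).hasDerivWithinAt (s := Icc (-1 : ℝ) t)
    have h2 := (he s (hsub hs)).mono hsub
    refine (h1.mul h2).congr_deriv ?_
    rw [hAa s (hsub hs)]
    ring
  have hb : ∀ s ∈ Icc (-1 : ℝ) t, ‖Complex.exp (F t - F s) * g s‖
      ≤ Real.exp (∫ s in (-1 : ℝ)..1, max (A s).re 0) * G := by
    intro s hs
    rw [norm_mul, Complex.norm_exp]
    have hd : F t - F s = ∫ x in s..t, A x :=
      intervalIntegral.integral_interval_sub_left (hAc.intervalIntegrable _ _)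
        (hAc.intervalIntegrable _ _)
    have hre : (F t - F s).re = ∫ x in s..t, (A x).re := by
      rw [hd]
      exact (Complex.reCLM.intervalIntegral_comp_comm (hAc.intervalIntegrable _ _)).symm
    have hle : (F t - F s).re ≤ ∫ s in (-1 : ℝ)..1, max (A s).re 0 := by
      rw [hre]
      calc _ ≤ ∫ x in s..t, max (A x).re 0 :=
            intervalIntegral.integral_mono_on hs.2
              ((Complex.continuous_re.comp hAc).intervalIntegrable _ _)
              (hmc.intervalIntegrable _ _) (fun x _ => le_max_left _ _)
        _ ≤ _ := intervalIntegral.integral_mono_interval hs.1 hs.2 ht.2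
              (Filter.Eventually.of_forall fun x => le_max_right _ _)
              (hmc.intervalIntegrable _ _)
    have := hg s (hsub hs)
    gcongr
  have hmv := Convex.norm_image_sub_le_of_norm_hasDerivWithin_le hh hb (convex_Icc _ _)
    (left_mem_Icc.2 ht.1) (right_mem_Icc.2 ht.1)
  simp only [sub_self, Complex.exp_zero, one_mul, he0, mul_zero, sub_zero] at hmv
  refine hmv.trans ?_
  have h2 : ‖t - -1‖ ≤ 2 := by
    rw [Real.norm_eq_abs, abs_le]; constructor <;> linarith [ht.1, ht.2]
  calc _ ≤ Real.exp (∫ s in (-1 : ℝ)..1, max (A s).re 0) * G * 2 := by gcongr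
    _ = _ := by ring

/-- a posteriori estimate for the Chebyshev collocation solution of a
scalar linear ODE initial value problem.  Here `q` plays the role of `I_N(a·p)` and
`w` the role of `I_N(u)` (the unique polynomials of degree `≤ N` interpolating
`a·p` resp. `u` at the `N+1` Chebyshev collocation points). -/
theorem apost_ivp
    (N : ℕ) (hN : 1 ≤ N)
    (a u : ℝ → ℂ)
    (ha : ContinuousOn a (Icc (-1 : ℝ) 1)) (hu : ContinuousOn u (Icc (-1 : ℝ) 1))
    (y0 : ℂ) (y : ℝ → ℂ)
    (hy : ∀ t ∈ Icc (-1 : ℝ) 1,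
      HasDerivWithinAt y (a t * y t + u t) (Icc (-1 : ℝ) 1) t)
    (hy0 : y (-1) = y0)
    (p : Polynomial ℂ) (hpdeg : p.natDegree ≤ N)
    (hcolloc : ∀ j < N,
      (Polynomial.derivative p).eval ((chebNode N j : ℝ) : ℂ)
        = a (chebNode N j) * p.eval ((chebNode N j : ℝ) : ℂ) + u (chebNode N j))
    (hpinit : p.eval ((-1 : ℝ) : ℂ) = y0)
    (q : Polynomial ℂ) (hqdeg : q.natDegree ≤ N)
    (hq : ∀ j ≤ N, q.eval ((chebNode N j : ℝ) : ℂ)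
        = a (chebNode N j) * p.eval ((chebNode N j : ℝ) : ℂ))
    (w : Polynomial ℂ) (hwdeg : w.natDegree ≤ N)
    (hw : ∀ j ≤ N, w.eval ((chebNode N j : ℝ) : ℂ) = u (chebNode N j))
    (Ca : ℝ) (hCa : Ca = Real.exp (∫ s in (-1 : ℝ)..1, max (a s).re 0))
    (Rp : ℂ)
    (hRp : Rp = (Polynomial.derivative p).eval ((-1 : ℝ) : ℂ) - a (-1) * y0 - u (-1)) :
    supNorm (fun t => y t - p.eval ((t : ℝ) : ℂ))
      ≤ 2 * Ca * (supNorm (fun t => a t * p.eval ((t : ℝ) : ℂ) - q.eval ((t : ℝ) : ℂ))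
          + supNorm (fun t => u t - w.eval ((t : ℝ) : ℂ)) + ‖Rp‖) := by
  have : Nonempty (Icc (-1 : ℝ) 1) := ⟨⟨0, by norm_num, by norm_num⟩⟩
  obtain ⟨M, rfl⟩ : ∃ M, N = M + 1 := ⟨N - 1, by omega⟩
  have hn : chebNode (M + 1) (M + 1) = -1 := by
    unfold chebNode
    rw [mul_div_assoc, mul_div_cancel₀ _ (by positivity), Real.cos_pi]
  set r : ℂ[X] := derivative p - q - w with hr
  have hrdeg : r.natDegree ≤ M + 1 := by
    refine (natDegree_sub_le_of_le (natDegree_sub_le_of_le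
      ((natDegree_derivative_le p).trans (Nat.sub_le _ _)) le_rfl) le_rfl).trans ?_
    simp [hpdeg, hqdeg, hwdeg]
  have hr0 : ∀ j < M + 1, r.eval ((chebNode (M + 1) j : ℝ) : ℂ) = 0 := by
    intro j hj
    rw [hr, eval_sub, eval_sub, hcolloc j hj, hq j hj.le, hw j hj.le]
    ring
  have hrR : r.eval ((-1 : ℝ) : ℂ) = Rp := by
    have h1 := hq (M + 1) le_rfl
    have h2 := hw (M + 1) le_rfl
    rw [hn] at h1 h2
    rw [hr, eval_sub, eval_sub, h1, h2, hRp, hpinit]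
  have hpc : ∀ f : ℂ[X], Continuous fun t : ℝ => f.eval (t : ℂ) := fun f =>
    f.continuous.comp Complex.continuous_ofReal
  have hbound := aux_gronwall a (fun t => y t - p.eval (t : ℂ))
    (fun t => (a t * p.eval (t : ℂ) - q.eval (t : ℂ)) + (u t - w.eval (t : ℂ)) - r.eval (t : ℂ))
    ha (supNorm (fun t => a t * p.eval ((t : ℝ) : ℂ) - q.eval ((t : ℝ) : ℂ))
          + supNorm (fun t => u t - w.eval ((t : ℝ) : ℂ)) + ‖Rp‖) ?_ ?_ ?_
  · rw [hCa]
    unfold _root_.supNorm at hbound ⊢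
    exact ciSup_le fun t => hbound t t.2
  · intro t ht
    have h1 := ((p.hasDerivAt (t : ℂ)).comp_ofReal).hasDerivWithinAt (s := Icc (-1 : ℝ) 1)
    refine ((hy t ht).sub h1).congr_deriv ?_
    rw [hr, eval_sub, eval_sub]
    ring
  · simp only [hy0, hpinit, sub_self]
  · intro t ht
    refine (norm_sub_le _ _).trans (add_le_add ((norm_add_le _ _).trans (add_le_add ?_ ?_)) ?_)
    · exact aux_sup (fun t => a t * p.eval ((t : ℝ) : ℂ) - q.eval ((t : ℝ) : ℂ))
        ((ha.mul (hpc p).continuousOn).sub (hpc q).continuousOn) t ht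
    · exact aux_sup (fun t => u t - w.eval ((t : ℝ) : ℂ))
        (hu.sub (hpc w).continuousOn) t ht
    · rw [← hrR]
      exact aux_r M r hrdeg hr0 t ht
end

section
/- Let N ≥ 1, let a_0 ∈ ℂ with Re a_0 > 0, let u : [-1,1] → ℂ be continuous, and let y_0 ∈ ℂ. Suppose y : [-1,1] → ℂ is differentiable with y'(t) = a_0·y(t) + u(t) for all t ∈ [-1,1] and y(−1) = y_0, and suppose p is a polynomial of degree ≤ N satisfying p'(t_j) = a_0·p(t_j) + u(t_j) for j = 0,…,N−1 and p(−1) = y_0. Set R_p = p'(−1) − a_0·y_0 − u(−1) and c = (π(|a_0|+1)+4)·e^{2 Re a_0}/(2N²). Then ‖y − p‖_∞ ≤ 2·e^{2 Re a_0}·‖u − I_N(u)‖_∞ + c·|R_p|. -/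
open Set Polynomial

theorem chebNode_last (N : ℕ) (hN : 1 ≤ N) : chebNode N N = -1 := by
  have : (N : ℝ) ≠ 0 := by positivity
  unfold chebNode
  rw [mul_div_assoc, mul_div_cancel₀ _ this, Real.cos_pi]

theorem chebNode_inj (N : ℕ) (hN : 1 ≤ N) (i j : ℕ) (hi : i ≤ N) (hj : j ≤ N)
    (h : chebNode N i = chebNode N j) : i = j := by
  have hN' : (0 : ℝ) < N := by positivity
  have key : ∀ k : ℕ, k ≤ N → (k * Real.pi / N : ℝ) ∈ Icc 0 Real.pi := by
    intro k hk
    have hk' : (k : ℝ) ≤ N := by exact_mod_cast hk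
    refine ⟨by positivity, ?_⟩
    rw [div_le_iff₀ hN']
    nlinarith [Real.pi_pos]
  have := Real.injOn_cos (key i hi) (key j hj) h
  field_simp at this
  exact_mod_cast this

theorem cheb_deriv_node (N : ℕ) (hN : 1 ≤ N) (j : ℕ) (h0 : 0 < j) (hj : j < N) :
    (derivative (Chebyshev.T ℂ N)).eval ((chebNode N j : ℝ) : ℂ) = 0 := by
  have hN' : (0 : ℝ) < N := by positivity
  have hj' : (j : ℝ) < N := by exact_mod_cast hj
  have h1 := Chebyshev.U_real_cos (j * Real.pi / N) ((N : ℤ) - 1)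
  have hs : Real.sin (j * Real.pi / N) ≠ 0 := by
    apply ne_of_gt
    apply Real.sin_pos_of_pos_of_lt_pi
    · have := Real.pi_pos
      positivity
    · rw [div_lt_iff₀ hN']
      nlinarith [Real.pi_pos]
  have h2 : (((N : ℤ) - 1 : ℤ) + 1 : ℝ) * (j * Real.pi / N) = j * Real.pi := by
    push_cast
    field_simp
    ring
  rw [h2, Real.sin_nat_mul_pi] at h1
  have h3 := (mul_eq_zero.mp h1).resolve_right hs
  rw [Chebyshev.T_derivative_eq_U, eval_mul]
  unfold chebNode
  rw [← Chebyshev.complex_ofReal_eval_U, h3]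
  simp

theorem cheb_deriv_neg_one (N : ℕ) :
    ‖(derivative (Chebyshev.T ℂ N)).eval (-1 : ℂ)‖ = (N : ℝ) ^ 2 := by
  rw [Chebyshev.T_derivative_eq_U, eval_mul, Chebyshev.U_eval_neg_one]
  rcases Int.units_eq_one_or (Int.negOnePow ((N : ℤ) - 1)) with h | h <;>
  · rw [h]
    simp [sq]

theorem resid_eq (N : ℕ) (hN : 1 ≤ N) (q w : ℂ[X]) (hq : q.natDegree ≤ N) (hw : w.natDegree ≤ N)
    (h : ∀ j < N, q.eval ((chebNode N j : ℝ) : ℂ) = w.eval ((chebNode N j : ℝ) : ℂ))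
    (R D : ℂ) (hR : q.eval (-1 : ℂ) = w.eval (-1 : ℂ) + R)
    (hD : D = 2 * (derivative (Chebyshev.T ℂ N)).eval (-1 : ℂ)) :
    q = w + C (R / D) * ((1 - X) * derivative (Chebyshev.T ℂ N)) := by
  have hD0 : D ≠ 0 := by
    rw [hD]
    refine mul_ne_zero two_ne_zero ?_
    rw [← norm_ne_zero_iff, cheb_deriv_neg_one]
    positivity
  have hinj : Set.InjOn (fun j : ℕ => ((chebNode N j : ℝ) : ℂ)) (Finset.range (N + 1)) := by
    intro i hi j hj hij
    simp only [Finset.coe_range, Set.mem_Iio] at hi hj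
    exact chebNode_inj N hN i j (by omega) (by omega) (Complex.ofReal_injective hij)
  have hdeg : ∀ r : ℂ[X], r.natDegree ≤ N → r.degree < (Finset.range (N + 1)).card := by
    intro r hr
    rw [Finset.card_range]
    refine lt_of_le_of_lt degree_le_natDegree ?_
    exact_mod_cast Nat.lt_succ_of_le hr
  refine Polynomial.eq_of_degrees_lt_of_eval_index_eq _ hinj (hdeg _ hq) (hdeg _ ?_) ?_
  · refine natDegree_add_le_of_degree_le hw ?_
    refine (natDegree_C_mul_le _ _).trans (natDegree_mul_le.trans ?_)
    have h1 : (1 - X : ℂ[X]).natDegree ≤ 1 := by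
      refine (natDegree_sub_le _ _).trans ?_
      simp
    have h2 : (derivative (Chebyshev.T ℂ N)).natDegree ≤ N - 1 := by
      refine (natDegree_derivative_le _).trans ?_
      rw [Chebyshev.natDegree_T]
      simp
    omega
  · intro j hj
    have hj' : j ≤ N := by simpa [Nat.lt_succ_iff] using hj
    rcases Nat.lt_or_eq_of_le hj' with hlt | rfl
    · simp only [eval_add, eval_mul, eval_C, eval_sub, eval_one, eval_X]
      rw [h j hlt]
      rcases Nat.eq_zero_or_pos j with rfl | hpos
      · simp [chebNode]
      · rw [cheb_deriv_node N hN j hpos hlt]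
        simp
    · simp only [eval_add, eval_mul, eval_C, eval_sub, eval_one, eval_X]
      rw [chebNode_last j hN]
      push_cast
      rw [hR]
      have : (1 - (-1 : ℂ)) * (derivative (Chebyshev.T ℂ j)).eval (-1 : ℂ) = D := by
        rw [hD]; ring
      rw [this, div_mul_cancel₀ _ hD0]

/-- Gronwall-type bound. -/
theorem gron (a : ℂ) (ha : 0 < a.re) (F f : ℝ → ℂ) (d k m : ℝ)
    (hd : 0 ≤ d) (hk : 0 ≤ k)  (hm : 0 ≤ m)
    (hF : ∀ t ∈ Icc (-1 : ℝ) 1, HasDerivWithinAt F (a * F t + f t) (Icc (-1 : ℝ) 1) t)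
    (hf : ∀ t ∈ Icc (-1 : ℝ) 1, ‖f t‖ ≤ d + k * (1 - t))
    (h0 : ‖F (-1)‖ ≤ m) (t : ℝ) (ht : t ∈ Icc (-1 : ℝ) 1) :
    ‖F t‖ ≤ Real.exp (2 * a.re) * (m + 2 * d + 2 * k) := by
  have hE : ∀ x : ℝ, HasDerivAt (fun x : ℝ => Complex.exp (-a * ((x : ℂ) + 1)))
      (Complex.exp (-a * ((x : ℂ) + 1)) * (-a)) x := by
    intro x
    have h1 : HasDerivAt (fun x : ℝ => -a * ((x : ℂ) + 1)) (-a) x := by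
      have := ((Complex.ofRealCLM.hasDerivAt (x := x)).add_const (1 : ℂ)).const_mul (-a)
      simpa using this
    exact h1.cexp
  have hnE : ∀ x : ℝ, ‖Complex.exp (-a * ((x : ℂ) + 1))‖ = Real.exp (-a.re * (x + 1)) := by
    intro x
    rw [Complex.norm_exp]
    simp
  have hG : ∀ x ∈ Icc (-1 : ℝ) 1, HasDerivWithinAt
      (fun x : ℝ => Complex.exp (-a * ((x : ℂ) + 1)) * F x)
      (Complex.exp (-a * ((x : ℂ) + 1)) * f x) (Icc (-1 : ℝ) 1) x := by
    intro x hx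
    refine ((hE x).hasDerivWithinAt.mul (hF x hx)).congr_deriv ?_
    ring
  have key := image_norm_le_of_norm_deriv_right_le_deriv_boundary
    (f := fun x : ℝ => Complex.exp (-a * ((x : ℂ) + 1)) * F x)
    (f' := fun x : ℝ => Complex.exp (-a * ((x : ℂ) + 1)) * f x) (a := -1) (b := 1)
    (B := fun x => m + d * (x + 1) + k * (2 - (1 - x) ^ 2 / 2))
    (B' := fun x => d + k * (1 - x))
    (fun x hx => (hG x hx).continuousWithinAt)
    (fun x hx => ((hG x ⟨hx.1, hx.2.le⟩).mono_of_mem_nhdsWithin (Icc_mem_nhdsGE_of_mem hx)))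
    (by simpa using by norm_num; exact h0)
    (by
      intro x
      have h1 := ((hasDerivAt_id x).add_const (1 : ℝ)).const_mul d
      have h2 := (((((hasDerivAt_id x).const_sub (1 : ℝ)).pow 2).div_const 2).const_sub 2).const_mul k
      have h3 := (h1.const_add m).add h2
      refine h3.congr_deriv ?_
      simp
      ring)
    (by
      intro x hx
      rw [norm_mul, hnE]
      have h1 : Real.exp (-a.re * (x + 1)) ≤ 1 := by
        rw [Real.exp_le_one_iff]
        nlinarith [hx.1]
      have h2 := hf x ⟨hx.1, hx.2.le⟩
      have := mul_le_of_le_one_left (norm_nonneg (f x)) h1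
      linarith)
    ht
  simp only [norm_mul, hnE] at key
  have h1 : m + d * (t + 1) + k * (2 - (1 - t) ^ 2 / 2) ≤ m + 2 * d + 2 * k := by
    nlinarith [ht.1, ht.2, mul_nonneg hd (sub_nonneg.2 ht.2), mul_nonneg hk (sq_nonneg (1 - t))]
  have h2 : Real.exp (a.re * (t + 1)) ≤ Real.exp (2 * a.re) := by
    rw [Real.exp_le_exp]
    nlinarith [ht.2]
  have h3 : ‖F t‖ = Real.exp (a.re * (t + 1)) * (Real.exp (-a.re * (t + 1)) * ‖F t‖) := by
    rw [← mul_assoc, ← Real.exp_add]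
    simp
  rw [h3]
  exact mul_le_mul h2 (key.trans h1) (by positivity) (by positivity)

/-- a posteriori estimate, constant coefficient case with
`Re a₀ > 0`.  Here `w` plays the role of `I_N(u)`, the unique polynomial of
degree `≤ N` interpolating `u` at the `N+1` Chebyshev collocation points. -/
theorem apost_ivp_const_pos
    (N : ℕ) (hN : 1 ≤ N)
    (a0 : ℂ) (ha0 : 0 < a0.re)
    (u : ℝ → ℂ) (hu : ContinuousOn u (Icc (-1 : ℝ) 1))
    (y0 : ℂ) (y : ℝ → ℂ)
    (hy : ∀ t ∈ Icc (-1 : ℝ) 1,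
      HasDerivWithinAt y (a0 * y t + u t) (Icc (-1 : ℝ) 1) t)
    (hy0 : y (-1) = y0)
    (p : Polynomial ℂ) (hpdeg : p.natDegree ≤ N)
    (hcolloc : ∀ j < N,
      (Polynomial.derivative p).eval ((chebNode N j : ℝ) : ℂ)
        = a0 * p.eval ((chebNode N j : ℝ) : ℂ) + u (chebNode N j))
    (hpinit : p.eval ((-1 : ℝ) : ℂ) = y0)
    (w : Polynomial ℂ) (hwdeg : w.natDegree ≤ N)
    (hw : ∀ j ≤ N, w.eval ((chebNode N j : ℝ) : ℂ) = u (chebNode N j))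
    (Rp : ℂ)
    (hRp : Rp = (Polynomial.derivative p).eval ((-1 : ℝ) : ℂ) - a0 * y0 - u (-1))
    (c : ℝ)
    (hc : c = (Real.pi * (‖a0‖ + 1) + 4) * Real.exp (2 * a0.re) / (2 * N ^ 2)) :
    supNorm (fun t => y t - p.eval ((t : ℝ) : ℂ))
      ≤ 2 * Real.exp (2 * a0.re) * supNorm (fun t => u t - w.eval ((t : ℝ) : ℂ))
        + c * ‖Rp‖ := by
  have hD0 : (0 : ℝ) < 2 * (N : ℝ) ^ 2 := by positivity
  obtain ⟨D, hD⟩ : ∃ D : ℂ, D = 2 * (derivative (Chebyshev.T ℂ N)).eval (-1 : ℂ) := ⟨_, rfl⟩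
  have hDn : ‖D‖ = 2 * (N : ℝ) ^ 2 := by
    rw [hD, norm_mul, cheb_deriv_neg_one]
    simp
  have hlast := chebNode_last N hN
  have hres := resid_eq N hN (derivative p - C a0 * p) w
    ((natDegree_sub_le _ _).trans (max_le ((natDegree_derivative_le p).trans (by omega))
      ((natDegree_C_mul_le _ _).trans hpdeg))) hwdeg
    (by
      intro j hj
      rw [hw j hj.le]
      simp only [eval_sub, eval_mul, eval_C]
      rw [hcolloc j hj]
      ring) Rp D
    (by
      have h1 := hw N le_rfl
      rw [hlast] at h1
      push_cast at h1 hRp hpinit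
      simp only [eval_sub, eval_mul, eval_C]
      rw [h1, hRp, hpinit]
      ring) hD
  have hpde : ∀ z : ℂ, (derivative p).eval z = a0 * p.eval z + w.eval z +
      (Rp / D) * ((1 - z) * (derivative (Chebyshev.T ℂ N)).eval z) := by
    intro z
    have := congrArg (eval z) hres
    simp only [eval_sub, eval_mul, eval_C, eval_add, eval_one, eval_X] at this
    linear_combination this
  have hT : ∀ t ∈ Icc (-1 : ℝ) 1, ‖(Chebyshev.T ℂ N).eval (t : ℂ)‖ ≤ 1 := by
    intro t ht
    rw [← Chebyshev.complex_ofReal_eval_T, Complex.norm_real]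
    exact Chebyshev.abs_eval_T_real_le_one N (abs_le.2 ht)
  have hbdd : BddAbove (Set.range fun t : Set.Icc (-1 : ℝ) 1 =>
      ‖u t - w.eval (((t : ℝ)) : ℂ)‖) := by
    have hc : ContinuousOn (fun t : ℝ => ‖u t - w.eval (t : ℂ)‖) (Icc (-1 : ℝ) 1) := by
      refine (hu.sub ?_).norm
      exact (w.continuous.comp Complex.continuous_ofReal).continuousOn
    have := (isCompact_Icc.image_of_continuousOn hc).bddAbove
    rwa [Set.image_eq_range] at this
  obtain ⟨δ, hδ⟩ : ∃ δ, δ = supNorm (fun t => u t - w.eval ((t : ℝ) : ℂ)) := ⟨_, rfl⟩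
  have hδb : ∀ t ∈ Icc (-1 : ℝ) 1, ‖u t - w.eval (t : ℂ)‖ ≤ δ := by
    intro t ht
    rw [hδ]
    exact le_ciSup hbdd ⟨t, ht⟩
  have hδ0 : 0 ≤ δ := (norm_nonneg _).trans (hδb 0 (by simp))
  rw [← hδ]
  obtain ⟨κ, hκ⟩ : ∃ κ, κ = ‖Rp‖ / (2 * (N : ℝ) ^ 2) := ⟨_, rfl⟩
  have hκ0 : 0 ≤ κ := by rw [hκ]; positivity
  have hκn : ‖Rp / D‖ = κ := by rw [norm_div, hDn, hκ]
  have hS : ∀ t ∈ Icc (-1 : ℝ) 1,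
      ‖(Rp / D) * ((1 - (t : ℂ)) * (Chebyshev.T ℂ N).eval (t : ℂ))‖ ≤ κ * 2 := by
    intro t ht
    rw [norm_mul, norm_mul, hκn]
    have h1 : ‖(1 - (t : ℂ))‖ = 1 - t := by
      rw [show (1 - (t : ℂ)) = ((1 - t : ℝ) : ℂ) by push_cast; rfl, Complex.norm_real,
        Real.norm_of_nonneg (sub_nonneg.2 ht.2)]
    rw [h1]
    refine mul_le_mul_of_nonneg_left ?_ hκ0
    have h2 := mul_le_of_le_one_right (sub_nonneg.2 ht.2) (hT t ht)
    linarith [ht.1]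
  have hder : ∀ (r : ℂ[X]) (t : ℝ), HasDerivWithinAt (fun t : ℝ => r.eval (t : ℂ))
      ((derivative r).eval (t : ℂ)) (Icc (-1 : ℝ) 1) t := fun r t =>
    (r.hasDerivAt (t : ℂ)).comp_ofReal.hasDerivWithinAt
  have hgr := gron a0 ha0
    (fun t => y t - p.eval (t : ℂ) +
      (Rp / D) * ((1 - (t : ℂ)) * (Chebyshev.T ℂ N).eval (t : ℂ)))
    (fun t => (u t - w.eval (t : ℂ)) -
      (Rp / D) * ((a0 * (1 - (t : ℂ)) + 1) * (Chebyshev.T ℂ N).eval (t : ℂ)))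
    (δ + κ) (κ * ‖a0‖) (κ * 2) (by positivity) (by positivity) (by positivity)
    (by
      intro t ht
      have h1 := hder ((1 - X) * Chebyshev.T ℂ N) t
      have h2 := ((hy t ht).sub (hder p t)).add (h1.const_mul (Rp / D))
      simp only [eval_mul, eval_sub, eval_one, eval_X] at h2
      refine h2.congr_deriv ?_
      rw [hpde]
      simp only [derivative_mul, derivative_sub, derivative_one, derivative_X, eval_add, eval_mul,
        eval_sub, eval_one, eval_X, eval_zero]
      ring)
    (by
      intro t ht
      have h1 : ‖(1 - (t : ℂ))‖ = 1 - t := by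
        rw [show (1 - (t : ℂ)) = ((1 - t : ℝ) : ℂ) by push_cast; rfl, Complex.norm_real,
          Real.norm_of_nonneg (sub_nonneg.2 ht.2)]
      refine (norm_sub_le _ _).trans ?_
      have h2 : ‖a0 * (1 - (t : ℂ)) + 1‖ ≤ ‖a0‖ * (1 - t) + 1 := by
        refine (norm_add_le _ _).trans ?_
        rw [norm_mul, h1, norm_one]
      have h3 : ‖(Rp / D) * ((a0 * (1 - (t : ℂ)) + 1) * (Chebyshev.T ℂ N).eval (t : ℂ))‖
          ≤ κ * (‖a0‖ * (1 - t) + 1) := by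
        rw [norm_mul, norm_mul, hκn]
        refine mul_le_mul_of_nonneg_left ?_ hκ0
        exact (mul_le_of_le_one_right (norm_nonneg _) (hT t ht)).trans h2
      have h4 := hδb t ht
      linarith)
    (by
      have h1 := hS (-1) (by simp)
      simp only [hy0, hpinit, sub_self, zero_add]
      exact h1)
  have hcR : c * ‖Rp‖ = κ * ((Real.pi * (‖a0‖ + 1) + 4) * Real.exp (2 * a0.re)) := by
    rw [hc, hκ]; ring
  rw [hcR]
  unfold _root_.supNorm
  haveI : Nonempty (Set.Icc (-1 : ℝ) 1) := ⟨⟨0, by simp⟩⟩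
  refine ciSup_le ?_
  rintro ⟨t, ht⟩
  have h1 := hgr t ht
  have h2 := hS t ht
  have h3 : ‖y t - p.eval (t : ℂ)‖ ≤ Real.exp (2 * a0.re) *
      (κ * 2 + 2 * (δ + κ) + 2 * (κ * ‖a0‖)) + κ * 2 := by
    have h4 := norm_sub_le (y t - p.eval (t : ℂ) +
      (Rp / D) * ((1 - (t : ℂ)) * (Chebyshev.T ℂ N).eval (t : ℂ)))
      ((Rp / D) * ((1 - (t : ℂ)) * (Chebyshev.T ℂ N).eval (t : ℂ)))
    rw [add_sub_cancel_right] at h4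
    linarith
  refine h3.trans ?_
  have hE : 1 ≤ Real.exp (2 * a0.re) := Real.one_le_exp (by linarith)
  have hpi := Real.pi_gt_three
  have h5 : κ * 2 ≤ κ * 2 * Real.exp (2 * a0.re) := le_mul_of_one_le_right (by positivity) hE
  have h6 : 0 ≤ κ * Real.exp (2 * a0.re) * ((Real.pi - 2) * (‖a0‖ + 1)) := by
    have : 0 ≤ Real.pi - 2 := by linarith
    positivity
  nlinarith
end

section
/- Let N ≥ 1, let a_0 ∈ ℂ with Re a_0 ≤ 0, let u : [-1,1] → ℂ be continuous, and let y_0 ∈ ℂ. Suppose y : [-1,1] → ℂ is differentiable with y'(t) = a_0·y(t) + u(t) for all t ∈ [-1,1] and y(−1) = y_0, and suppose p is a polynomial of degree ≤ N satisfying p'(t_j) = a_0·p(t_j) + u(t_j) for j = 0,…,N−1 and p(−1) = y_0. Set R_p = p'(−1) − a_0·y_0 − u(−1) and c̃ = (π(|a_0|+1)+4)·e^{−2 Re a_0}/(2N²). Then ‖y − p‖_∞ ≤ 2·‖u − I_N(u)‖_∞ + min(c̃, π/(2N))·|R_p|. -/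
open Set Polynomial

/-- A polynomial of degree at most `N` vanishing at all Chebyshev nodes but `-1`. -/
lemma poly_repr (N : ℕ) (hN : 1 ≤ N) (r : Polynomial ℂ) (hr : r.natDegree ≤ N)
    (h0 : ∀ j < N, r.eval ((chebNode N j : ℝ) : ℂ) = 0) :
    ∃ κ : ℂ, ‖κ‖ = ‖r.eval (-1)‖ / (2 * N ^ 2) ∧
      r = C κ * ((X - 1) * derivative (Chebyshev.T ℂ N)) := by
  have hN0 : (N : ℂ) ≠ 0 := by exact_mod_cast (by omega : N ≠ 0)
  have hNR : (0 : ℝ) < N := by exact_mod_cast hN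
  set s : ℂ := ((((N : ℤ) - 1).negOnePow : ℤ) : ℂ) with hs
  have hsn : ‖s‖ = 1 := by
    rcases Int.even_or_odd ((N : ℤ) - 1) with h | h
    · simp [hs, Int.negOnePow_even _ h]
    · simp [hs, Int.negOnePow_odd _ h]
  have hs0 : s ≠ 0 := by
    intro h; rw [h] at hsn; simp at hsn
  have hm1 : eval (-1) (derivative (Chebyshev.T ℂ N)) = s * N ^ 2 := by
    rw [Chebyshev.T_derivative_eq_U]
    rw [eval_mul, Chebyshev.U_eval_neg_one, hs]
    simp only [Int.cast_natCast, eval_natCast]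
    push_cast
    ring
  refine ⟨r.eval (-1) / (-2 * (s * N ^ 2)), ?_, ?_⟩
  · simp [hsn]
  set κ := r.eval (-1) / (-2 * (s * N ^ 2)) with hκ
  rw [← sub_eq_zero]
  have hnode : ∀ j : ℕ, j ≤ N → (j : ℝ) * Real.pi / N ∈ Icc 0 Real.pi := by
    intro j hj
    have hj' : (j : ℝ) ≤ N := by exact_mod_cast hj
    refine ⟨by positivity, ?_⟩
    rw [div_le_iff₀ hNR]
    nlinarith [Real.pi_pos]
  refine Polynomial.eq_zero_of_natDegree_lt_card_of_eval_eq_zero _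
    (f := fun j : Fin (N + 1) => ((chebNode N j : ℝ) : ℂ)) ?_ ?_ ?_
  · intro i j hij
    have h1 : chebNode N i = chebNode N j := Complex.ofReal_injective hij
    have h2 := Real.injOn_cos (hnode i (by omega)) (hnode j (by omega)) h1
    field_simp at h2
    have h3 : (i : ℕ) = j := by exact_mod_cast h2
    exact Fin.ext h3
  · intro j
    rcases Nat.lt_or_ge j N with hj | hj
    · rw [eval_sub, h0 _ hj]
      rcases Nat.eq_zero_or_pos (j : ℕ) with hj0 | hj0
      · simp [hj0, chebNode]
      · have hU := Chebyshev.U_complex_cos (((j : ℕ) : ℝ) * Real.pi / N : ℝ) ((N : ℤ) - 1)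
        have hsin : Real.sin (((j : ℕ) : ℝ) * Real.pi / N) ≠ 0 := by
          apply ne_of_gt
          apply Real.sin_pos_of_pos_of_lt_pi
          · positivity
          · rw [div_lt_iff₀ hNR]
            have : ((j : ℕ) : ℝ) < N := by exact_mod_cast hj
            nlinarith [Real.pi_pos]
        have hz : Complex.sin (((((N : ℤ) - 1 : ℤ) : ℂ) + 1) *
            ((((j : ℕ) : ℝ) * Real.pi / N : ℝ) : ℂ)) = 0 := by
          rw [← Complex.sin_nat_mul_pi j]
          congr 1
          push_cast
          field_simp
          ring
        rw [hz, mul_eq_zero, ← Complex.ofReal_sin, Complex.ofReal_eq_zero] at hU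
        have hU' := hU.resolve_right hsin
        rw [← Complex.ofReal_cos] at hU'
        have : eval ((chebNode N j : ℝ) : ℂ) (Chebyshev.U ℂ ((N : ℤ) - 1)) = 0 := hU'
        rw [Chebyshev.T_derivative_eq_U]
        simp [this]
    · have hjN : (j : ℕ) = N := by omega
      have : chebNode N j = -1 := by
        rw [hjN, chebNode, mul_div_cancel_left₀ _ hNR.ne', Real.cos_pi]
      rw [this]
      push_cast
      simp only [eval_sub, eval_mul, eval_C, eval_X, eval_one, hm1, hκ]
      field_simp
      ring
  · have h1 : (derivative (Chebyshev.T ℂ N)).natDegree ≤ N - 1 := by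
      refine (natDegree_derivative_le _).trans ?_
      simp
    have h2 : ((X - 1 : ℂ[X]) * derivative (Chebyshev.T ℂ N)).natDegree ≤ 1 + (N - 1) := by
      refine natDegree_mul_le.trans (add_le_add ?_ h1)
      exact (natDegree_X_sub_C_le (1 : ℂ))
    have h3 := (natDegree_C_mul_le κ ((X - 1 : ℂ[X]) * derivative (Chebyshev.T ℂ N))).trans h2
    have h4 := (natDegree_sub_le r (C κ * ((X - 1 : ℂ[X]) * derivative (Chebyshev.T ℂ N))))
    rw [Fintype.card_fin]
    omega

lemma T_norm_le (N : ℕ) {t : ℝ} (ht : t ∈ Icc (-1 : ℝ) 1) :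
    ‖eval (t : ℂ) (Chebyshev.T ℂ N)‖ ≤ 1 := by
  rw [← Chebyshev.complex_ofReal_eval_T, Complex.norm_real]
  exact Chebyshev.abs_eval_T_real_le_one _ (abs_le.mpr ht)

lemma dT_norm_le (N : ℕ) (θ : ℝ) :
    ‖eval ((-Real.cos θ : ℝ) : ℂ) (derivative (Chebyshev.T ℂ N))‖ * |Real.sin θ| ≤ N := by
  have hU := Chebyshev.U_real_cos (Real.pi - θ) ((N : ℤ) - 1)
  rw [Real.cos_pi_sub, Real.sin_pi_sub] at hU
  have h1 : |eval (-Real.cos θ) (Chebyshev.U ℝ ((N : ℤ) - 1))| * |Real.sin θ| ≤ 1 := by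
    rw [← abs_mul, hU]; exact Real.abs_sin_le_one _
  rw [Chebyshev.T_derivative_eq_U, eval_mul, ← Chebyshev.complex_ofReal_eval_U, norm_mul,
    Complex.norm_real, Real.norm_eq_abs]
  simp only [Int.cast_natCast, eval_natCast, Complex.norm_natCast]
  nlinarith [Nat.cast_nonneg (α := ℝ) N]

lemma hasDeriv_exp (a0 : ℂ) (t s : ℝ) :
    HasDerivAt (fun s : ℝ => Complex.exp (a0 * ((t - s : ℝ) : ℂ)))
      (Complex.exp (a0 * ((t - s : ℝ) : ℂ)) * (-a0)) s := by
  have h1 : HasDerivAt (fun s : ℝ => ((t - s : ℝ) : ℂ)) (((-1 : ℝ)) : ℂ) s :=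
    ((hasDerivAt_id s).const_sub t).ofReal_comp
  have := (h1.const_mul a0).cexp
  simpa using this

lemma norm_exp_le (a0 : ℂ) (ha0 : a0.re ≤ 0) {t s : ℝ} (h : s ≤ t) :
    ‖Complex.exp (a0 * ((t - s : ℝ) : ℂ))‖ ≤ 1 := by
  rw [Complex.norm_exp, Complex.re_mul_ofReal, Real.exp_le_one_iff]
  exact mul_nonpos_of_nonpos_of_nonneg ha0 (by linarith)

/-- the bound with `π / (2N)` -/
lemma bound_one (N : ℕ) (a0 : ℂ) (ha0 : a0.re ≤ 0) (e F : ℝ → ℂ) (κ : ℂ) (M : ℝ)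
    (he : ∀ t ∈ Icc (-1 : ℝ) 1, HasDerivWithinAt e
      (a0 * e t + F t - κ * ((t - 1) * eval (t : ℂ) (derivative (Chebyshev.T ℂ N))))
      (Icc (-1 : ℝ) 1) t)
    (he0 : e (-1) = 0) (hF : ∀ t ∈ Icc (-1 : ℝ) 1, ‖F t‖ ≤ M)
    (t : ℝ) (ht : t ∈ Icc (-1 : ℝ) 1) :
    ‖e t‖ ≤ 2 * M + ‖κ‖ * (N * Real.pi) := by
  have hM : 0 ≤ M := (norm_nonneg _).trans (hF t ht)
  set τ := Real.pi - Real.arccos t with hτ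
  have hcosτ : -Real.cos τ = t := by
    rw [hτ, Real.cos_pi_sub, Real.cos_arccos ht.1 ht.2, neg_neg]
  have hτ0 : 0 ≤ τ := by linarith [Real.arccos_le_pi t]
  have hτπ : τ ≤ Real.pi := by linarith [Real.arccos_nonneg t]
  have hmaps : ∀ θ : ℝ, -Real.cos θ ∈ Icc (-1 : ℝ) 1 := fun θ =>
    ⟨by linarith [Real.cos_le_one θ], by linarith [Real.neg_one_le_cos θ]⟩
  set g : ℝ → ℂ := fun s => Complex.exp (a0 * ((t - s : ℝ) : ℂ)) * e s with hg
  set g' : ℝ → ℂ := fun s => Complex.exp (a0 * ((t - s : ℝ) : ℂ)) *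
    (F s - κ * ((s - 1) * eval (s : ℂ) (derivative (Chebyshev.T ℂ N)))) with hg'
  have hgd : ∀ s ∈ Icc (-1 : ℝ) 1, HasDerivWithinAt g (g' s) (Icc (-1 : ℝ) 1) s := by
    intro s hs
    refine ((hasDeriv_exp a0 t s).hasDerivWithinAt.mul (he s hs)).congr_deriv ?_
    simp only [hg']; ring
  have hcd : ∀ θ : ℝ, HasDerivAt (fun θ => -Real.cos θ) (Real.sin θ) θ := fun θ =>
    (Real.hasDerivAt_cos θ).neg.congr_deriv (neg_neg _)
  have hhd : ∀ θ : ℝ, HasDerivAt (fun θ => g (-Real.cos θ))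
      (Real.sin θ • g' (-Real.cos θ)) θ := by
    intro θ
    have := (hgd _ (hmaps θ)).scomp (h := fun θ => -Real.cos θ) θ (s := univ)
      (hcd θ).hasDerivWithinAt (fun x _ => hmaps x)
    exact hasDerivWithinAt_univ.mp this
  have hBd : ∀ θ : ℝ, HasDerivAt
      (fun θ => M * (1 - Real.cos θ) + ‖κ‖ * N * (θ + Real.sin θ))
      (M * Real.sin θ + ‖κ‖ * N * (1 + Real.cos θ)) θ := by
    intro θ
    have h1 := ((Real.hasDerivAt_cos θ).const_sub 1).const_mul M
    have h2 := ((hasDerivAt_id θ).add (Real.hasDerivAt_sin θ)).const_mul (‖κ‖ * N)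
    refine (h1.add h2).congr_deriv ?_
    ring
  have key := image_norm_le_of_norm_deriv_right_le_deriv_boundary'
    (f := fun θ => g (-Real.cos θ)) (f' := fun θ => Real.sin θ • g' (-Real.cos θ))
    (a := 0) (b := τ)
    (fun θ _ => (hhd θ).continuousAt.continuousWithinAt)
    (fun θ _ => (hhd θ).hasDerivWithinAt)
    (B := fun θ => M * (1 - Real.cos θ) + ‖κ‖ * N * (θ + Real.sin θ))
    (B' := fun θ => M * Real.sin θ + ‖κ‖ * N * (1 + Real.cos θ))
    (by simp [hg, he0])
    (fun θ _ => (hBd θ).continuousAt.continuousWithinAt)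
    (fun θ _ => (hBd θ).hasDerivWithinAt)
    (by
      intro θ hθ
      have hsin : 0 ≤ Real.sin θ := Real.sin_nonneg_of_nonneg_of_le_pi hθ.1 (by linarith [hθ.2])
      have hle : -Real.cos θ ≤ t := by
        rw [← hcosτ]
        linarith [Real.cos_le_cos_of_nonneg_of_le_pi hθ.1 hτπ hθ.2.le]
      have hE := norm_exp_le a0 ha0 hle
      have hdT := dT_norm_le N θ
      rw [abs_of_nonneg hsin] at hdT
      have hn : ‖(((-Real.cos θ : ℝ) : ℂ) - 1)‖ = 1 + Real.cos θ := by
        rw [← Complex.ofReal_one, ← Complex.ofReal_sub, Complex.norm_real, Real.norm_eq_abs,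
          abs_of_nonpos (by linarith [(hmaps θ).2])]
        ring
      have hc0 : 0 ≤ 1 + Real.cos θ := by linarith [Real.neg_one_le_cos θ]
      simp only [hg']
      rw [norm_smul, norm_mul, Real.norm_eq_abs, abs_of_nonneg hsin]
      set D := eval ((-Real.cos θ : ℝ) : ℂ) (derivative (Chebyshev.T ℂ N)) with hD
      have h1 : ‖F (-Real.cos θ) - κ * ((((-Real.cos θ : ℝ) : ℂ) - 1) * D)‖
          ≤ M + ‖κ‖ * ((1 + Real.cos θ) * ‖D‖) := by
        refine (norm_sub_le _ _).trans ?_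
        rw [norm_mul, norm_mul, hn]
        gcongr
        exact hF _ (hmaps θ)
      calc _ ≤ Real.sin θ * (1 * (M + ‖κ‖ * ((1 + Real.cos θ) * ‖D‖))) := by gcongr
        _ = M * Real.sin θ + ‖κ‖ * (1 + Real.cos θ) * (‖D‖ * Real.sin θ) := by ring
        _ ≤ M * Real.sin θ + ‖κ‖ * (1 + Real.cos θ) * N := by gcongr
        _ = _ := by ring)
    (right_mem_Icc.mpr hτ0)
  simp only [hg, hcosτ, sub_self, Complex.ofReal_zero, mul_zero, Complex.exp_zero, one_mul] at key
  refine key.trans ?_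
  have h1 : τ + Real.sin τ ≤ Real.pi := by
    have := Real.sin_le (x := Real.pi - τ) (by linarith)
    rw [Real.sin_pi_sub] at this
    linarith
  have h2 : 1 - Real.cos τ ≤ 2 := by linarith [ht.2]
  calc _ ≤ M * 2 + ‖κ‖ * N * Real.pi := by gcongr
    _ = _ := by ring

/-- the bound with `1 / N ^ 2` -/
lemma bound_two (N : ℕ) (a0 : ℂ) (ha0 : a0.re ≤ 0) (e F : ℝ → ℂ) (κ : ℂ) (M : ℝ)
    (he : ∀ t ∈ Icc (-1 : ℝ) 1, HasDerivWithinAt e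
      (a0 * e t + F t - κ * ((t - 1) * eval (t : ℂ) (derivative (Chebyshev.T ℂ N))))
      (Icc (-1 : ℝ) 1) t)
    (he0 : e (-1) = 0) (hF : ∀ t ∈ Icc (-1 : ℝ) 1, ‖F t‖ ≤ M)
    (t : ℝ) (ht : t ∈ Icc (-1 : ℝ) 1) :
    ‖e t‖ ≤ 2 * M + ‖κ‖ * (2 * (‖a0‖ + 1) + 4) := by
  have hM : 0 ≤ M := (norm_nonneg _).trans (hF t ht)
  have hsub : ∀ s ∈ Icc (-1 : ℝ) t, s ∈ Icc (-1 : ℝ) 1 := fun s hs => ⟨hs.1, hs.2.trans ht.2⟩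
  have hn : ∀ s ∈ Icc (-1 : ℝ) 1, ‖((s : ℂ) - 1)‖ = 1 - s := by
    intro s hs
    rw [← Complex.ofReal_one, ← Complex.ofReal_sub, Complex.norm_real, Real.norm_eq_abs,
      abs_of_nonpos (by linarith [hs.2])]
    ring
  set Q : ℝ → ℂ := fun s => eval (s : ℂ) (Chebyshev.T ℂ N) with hQ
  set g : ℝ → ℂ := fun s => Complex.exp (a0 * ((t - s : ℝ) : ℂ)) *
    (e s + κ * (((s : ℂ) - 1) * Q s)) with hg
  set g' : ℝ → ℂ := fun s => Complex.exp (a0 * ((t - s : ℝ) : ℂ)) *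
    (F s + κ * ((1 - a0 * ((s : ℂ) - 1)) * Q s)) with hg'
  have hgd : ∀ s ∈ Icc (-1 : ℝ) 1, HasDerivWithinAt g (g' s) (Icc (-1 : ℝ) 1) s := by
    intro s hs
    have hQd : HasDerivAt Q (eval (s : ℂ) (derivative (Chebyshev.T ℂ N))) s :=
      ((Chebyshev.T ℂ N).hasDerivAt (s : ℂ)).comp_ofReal
    have hX : HasDerivAt (fun s : ℝ => ((s : ℂ) - 1)) 1 s :=
      (hasDerivAt_id s).ofReal_comp.sub_const 1
    have h2 := (he s hs).add (((hX.mul hQd).const_mul κ).hasDerivWithinAt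
      (s := Icc (-1 : ℝ) 1))
    refine ((hasDeriv_exp a0 t s).hasDerivWithinAt.mul h2).congr_deriv ?_
    simp only [hg', Pi.add_apply, Pi.mul_apply]; ring
  have hBd : ∀ s : ℝ, HasDerivAt
      (fun s => 2 * ‖κ‖ + (M + ‖κ‖) * (s + 1) + ‖κ‖ * ‖a0‖ * (2 - (1 - s) ^ 2 / 2))
      (M + ‖κ‖ * (1 + ‖a0‖ * (1 - s))) s := by
    intro s
    have h1 := (((hasDerivAt_id s).add_const 1).const_mul (M + ‖κ‖)).const_add (2 * ‖κ‖)
    have h2 := (((((hasDerivAt_id s).const_sub 1).pow 2).div_const 2).const_sub 2).const_mul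
      (‖κ‖ * ‖a0‖)
    refine (h1.add h2).congr_deriv ?_
    simp
    ring
  have key := image_norm_le_of_norm_deriv_right_le_deriv_boundary'
    (f := g) (f' := g') (a := -1) (b := t)
    (fun s hs => ((hgd s (hsub s hs)).continuousWithinAt).mono hsub)
    (fun s hs => (hgd s (hsub s ⟨hs.1, hs.2.le⟩)).mono_of_mem_nhdsWithin
      (Icc_mem_nhdsGE_of_mem ⟨hs.1, hs.2.trans_le ht.2⟩))
    (B := fun s => 2 * ‖κ‖ + (M + ‖κ‖) * (s + 1) + ‖κ‖ * ‖a0‖ * (2 - (1 - s) ^ 2 / 2))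
    (B' := fun s => M + ‖κ‖ * (1 + ‖a0‖ * (1 - s)))
    (by
      have hE := norm_exp_le a0 ha0 ht.1
      have hq := T_norm_le N (left_mem_Icc.mpr (by norm_num : (-1 : ℝ) ≤ 1))
      have h2 := hn (-1) (left_mem_Icc.mpr (by norm_num : (-1 : ℝ) ≤ 1))
      simp only [hg, he0, zero_add, norm_mul, h2, hQ]
      calc _ ≤ 1 * (‖κ‖ * ((1 - -1) * 1)) := by gcongr
        _ = _ := by ring)
    (fun θ _ => (hBd θ).continuousAt.continuousWithinAt)
    (fun θ _ => (hBd θ).hasDerivWithinAt)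
    (by
      intro s hs
      have hs1 := hsub s ⟨hs.1, hs.2.le⟩
      have hE := norm_exp_le a0 ha0 hs.2.le
      have hq := T_norm_le N hs1
      have h1 : ‖1 - a0 * ((s : ℂ) - 1)‖ ≤ 1 + ‖a0‖ * (1 - s) := by
        refine (norm_sub_le _ _).trans ?_
        rw [norm_mul, hn s hs1, norm_one]
      have h0 : 0 ≤ 1 + ‖a0‖ * (1 - s) := (norm_nonneg _).trans h1
      have h2 : ‖F s + κ * ((1 - a0 * ((s : ℂ) - 1)) * Q s)‖
          ≤ M + ‖κ‖ * ((1 + ‖a0‖ * (1 - s)) * 1) := by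
        refine (norm_add_le _ _).trans ?_
        rw [norm_mul, norm_mul]
        gcongr
        exact hF _ hs1
      simp only [hg']
      rw [norm_mul]
      calc _ ≤ 1 * (M + ‖κ‖ * ((1 + ‖a0‖ * (1 - s)) * 1)) := by gcongr
        _ = _ := by ring)
    (right_mem_Icc.mpr ht.1)
  simp only [hg, sub_self, Complex.ofReal_zero, mul_zero, Complex.exp_zero, one_mul] at key
  have h3 : ‖e t‖ ≤ ‖e t + κ * (((t : ℂ) - 1) * Q t)‖ + ‖κ * (((t : ℂ) - 1) * Q t)‖ := by
    have := norm_sub_le (e t + κ * (((t : ℂ) - 1) * Q t)) (κ * (((t : ℂ) - 1) * Q t))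
    rwa [add_sub_cancel_right] at this
  have h4 : ‖κ * (((t : ℂ) - 1) * Q t)‖ ≤ ‖κ‖ * ((1 - t) * 1) := by
    have : 0 ≤ 1 - t := by linarith [ht.2]
    rw [norm_mul, norm_mul, hn t ht]
    gcongr
    exact T_norm_le N ht
  have h5 : M * (t + 1) ≤ M * 2 := by gcongr; linarith [ht.2]
  have h6 : ‖κ‖ * ‖a0‖ * (2 - (1 - t) ^ 2 / 2) ≤ ‖κ‖ * ‖a0‖ * 2 := by
    gcongr; linarith [sq_nonneg (1 - t)]
  nlinarith [norm_nonneg κ]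

/-- a posteriori estimate, constant coefficient case with
`Re a₀ ≤ 0`.  Here `w` plays the role of `I_N(u)`, the unique polynomial of
degree `≤ N` interpolating `u` at the `N+1` Chebyshev collocation points. -/
theorem apost_ivp_const_nonpos
    (N : ℕ) (hN : 1 ≤ N)
    (a0 : ℂ) (ha0 : a0.re ≤ 0)
    (u : ℝ → ℂ) (hu : ContinuousOn u (Icc (-1 : ℝ) 1))
    (y0 : ℂ) (y : ℝ → ℂ)
    (hy : ∀ t ∈ Icc (-1 : ℝ) 1,
      HasDerivWithinAt y (a0 * y t + u t) (Icc (-1 : ℝ) 1) t)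
    (hy0 : y (-1) = y0)
    (p : Polynomial ℂ) (hpdeg : p.natDegree ≤ N)
    (hcolloc : ∀ j < N,
      (Polynomial.derivative p).eval ((chebNode N j : ℝ) : ℂ)
        = a0 * p.eval ((chebNode N j : ℝ) : ℂ) + u (chebNode N j))
    (hpinit : p.eval ((-1 : ℝ) : ℂ) = y0)
    (w : Polynomial ℂ) (hwdeg : w.natDegree ≤ N)
    (hw : ∀ j ≤ N, w.eval ((chebNode N j : ℝ) : ℂ) = u (chebNode N j))
    (Rp : ℂ)
    (hRp : Rp = (Polynomial.derivative p).eval ((-1 : ℝ) : ℂ) - a0 * y0 - u (-1))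
    (ctilde : ℝ)
    (hc : ctilde = (Real.pi * (‖a0‖ + 1) + 4) * Real.exp (-(2 * a0.re)) / (2 * N ^ 2)) :
    supNorm (fun t => y t - p.eval ((t : ℝ) : ℂ))
      ≤ 2 * supNorm (fun t => u t - w.eval ((t : ℝ) : ℂ))
        + min ctilde (Real.pi / (2 * N)) * ‖Rp‖ := by

  have hNR : (0 : ℝ) < N := by exact_mod_cast hN
  have hnodeN : chebNode N N = -1 := by
    rw [chebNode, mul_div_cancel_left₀ _ hNR.ne', Real.cos_pi]
  set M := supNorm (fun t => u t - w.eval ((t : ℝ) : ℂ)) with hMdef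
  have hF : ∀ t ∈ Icc (-1 : ℝ) 1, ‖u t - w.eval ((t : ℝ) : ℂ)‖ ≤ M := by
    intro t ht
    have hcont : ContinuousOn (fun t : ℝ => ‖u t - w.eval ((t : ℝ) : ℂ)‖) (Icc (-1 : ℝ) 1) :=
      (hu.sub (w.continuous.comp Complex.continuous_ofReal).continuousOn).norm
    have hb := isCompact_Icc.bddAbove_image hcont
    have hb' : BddAbove (range fun t : Icc (-1 : ℝ) 1 => ‖u t - w.eval ((t : ℝ) : ℂ)‖) := by
      rw [image_eq_range] at hb
      exact hb
    exact le_ciSup hb' ⟨t, ht⟩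
  obtain ⟨κ, hκ, hr⟩ := poly_repr N hN (derivative p - C a0 * p - w)
    (by
      have h1 := (natDegree_derivative_le p)
      have h2 := natDegree_C_mul_le a0 p
      have h3 := natDegree_sub_le (derivative p) (C a0 * p)
      have h4 := natDegree_sub_le (derivative p - C a0 * p) w
      omega)
    (by
      intro j hj
      simp only [eval_sub, eval_mul, eval_C, hcolloc j hj, hw j hj.le]
      ring)
  have hRκ : ‖κ‖ = ‖Rp‖ / (2 * N ^ 2) := by
    rw [hκ, hRp]
    have h1 := hw N le_rfl
    rw [hnodeN] at h1
    rw [← hpinit, ← h1]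
    simp
  have he : ∀ t ∈ Icc (-1 : ℝ) 1, HasDerivWithinAt (fun t => y t - p.eval ((t : ℝ) : ℂ))
      (a0 * (y t - p.eval ((t : ℝ) : ℂ)) + (u t - w.eval ((t : ℝ) : ℂ))
        - κ * ((t - 1) * eval (t : ℂ) (derivative (Chebyshev.T ℂ N))))
      (Icc (-1 : ℝ) 1) t := by
    intro t ht
    have h1 : HasDerivAt (fun t : ℝ => p.eval ((t : ℝ) : ℂ)) (eval (t : ℂ) (derivative p)) t :=
      (p.hasDerivAt (t : ℂ)).comp_ofReal
    refine ((hy t ht).sub h1.hasDerivWithinAt).congr_deriv ?_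
    have h2 := congrArg (eval (t : ℂ)) hr
    simp only [eval_sub, eval_mul, eval_C, eval_X, eval_one] at h2
    rw [← h2]
    ring
  have he0 : y (-1) - p.eval (((-1 : ℝ) : ℝ) : ℂ) = 0 := by rw [hy0, hpinit, sub_self]
  have : Nonempty (Icc (-1 : ℝ) 1) := ⟨⟨-1, by norm_num⟩⟩
  refine ciSup_le ?_
  rintro ⟨t, ht⟩
  have b1 := bound_one N a0 ha0 _ _ κ M he he0 hF t ht
  have b2 := bound_two N a0 ha0 _ _ κ M he he0 hF t ht
  simp only
  rw [min_mul_of_nonneg _ _ (norm_nonneg _), ← min_add_add_left]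
  refine le_min ?_ ?_
  · refine b2.trans (add_le_add le_rfl ?_)
    rw [hRκ, hc]
    have hexp : 1 ≤ Real.exp (-(2 * a0.re)) := Real.one_le_exp (by linarith)
    have h3 : 2 * (‖a0‖ + 1) + 4 ≤ (Real.pi * (‖a0‖ + 1) + 4) * Real.exp (-(2 * a0.re)) := by
      have h4 : 2 * (‖a0‖ + 1) ≤ Real.pi * (‖a0‖ + 1) := by
        gcongr; exact Real.two_le_pi
      have h5 : 0 ≤ Real.pi * (‖a0‖ + 1) + 4 := by positivity
      nlinarith
    calc _ = (2 * (‖a0‖ + 1) + 4) / (2 * N ^ 2) * ‖Rp‖ := by ring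
      _ ≤ _ := by gcongr
  · refine b1.trans (le_of_eq ?_)
    rw [hRκ]
    field_simp
end

section
/- Let f : [-1,1] → ℂ be continuously differentiable. Then Σ_{k=0}^∞ (1+k)²·|f̂_k|² ≤ 2π·‖f‖_∞² + 2π·‖f'‖_∞²; that is, ‖f‖_{H¹}² ≤ 2π(‖f‖_∞² + ‖f'‖_∞²). -/
open Set

/-- The normalized Chebyshev polynomials: `T̂_0(t) = π^{-1/2}` and
`T̂_k(t) = √(2/π)·cos(k·arccos t)` for `k ≥ 1`. -/
noncomputable def That (k : ℕ) (t : ℝ) : ℝ :=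
  if k = 0 then Real.sqrt (1 / Real.pi)
  else Real.sqrt (2 / Real.pi) * Real.cos (k * Real.arccos t)

/-- The Chebyshev expansion coefficients
`f̂_k = ∫_{-1}^1 T̂_k(t)·f(t)·(1−t²)^{-1/2} dt`. -/
noncomputable def chebCoeff (f : ℝ → ℂ) (k : ℕ) : ℂ :=
  ∫ t in (-1 : ℝ)..1, (That k t : ℂ) * f t * ((Real.sqrt (1 - t ^ 2) : ℝ) : ℂ)⁻¹

open MeasureTheory in
lemma bessel_aux (φ : ℕ → ℝ → ℝ) (hφ : ∀ k, Continuous (φ k))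
    (horth : ∀ j k, ∫ x in (0:ℝ)..Real.pi, φ j x * φ k x = if j = k then 1 else 0)
    (g : ℝ → ℂ) (hg : Continuous g) (n : ℕ) :
    ∑ k ∈ Finset.range n, ‖∫ x in (0:ℝ)..Real.pi, (φ k x : ℂ) * g x‖ ^ 2
      ≤ ∫ x in (0:ℝ)..Real.pi, ‖g x‖ ^ 2 := by
  have hpi := Real.pi_pos.le
  have hmem : ∀ h : ℝ → ℂ, Continuous h → MemLp h 2 (volume.restrict (Ioc 0 Real.pi)) := by
    intro h hh
    rw [memLp_two_iff_integrable_sq_norm hh.aestronglyMeasurable]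
    exact ((hh.norm.pow 2).integrableOn_Icc (a := 0) (b := Real.pi)).mono_set Ioc_subset_Icc_self
  have hc : ∀ k, Continuous (fun x => (φ k x : ℂ)) := fun k => by have := hφ k; fun_prop
  have hinner : ∀ (a b : ℝ → ℂ) (ha : Continuous a) (hb : Continuous b),
      inner ℂ ((hmem a ha).toLp a) ((hmem b hb).toLp b)
        = ∫ x in (0:ℝ)..Real.pi, (starRingEnd ℂ) (a x) * b x := by
    intro a b ha hb
    rw [L2.inner_def, intervalIntegral.integral_of_le hpi]
    apply integral_congr_ae
    filter_upwards [(hmem a ha).coeFn_toLp, (hmem b hb).coeFn_toLp] with x h1 h2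
    rw [h1, h2, RCLike.inner_apply, mul_comm]
  have hv : Orthonormal ℂ (fun k => (hmem _ (hc k)).toLp (fun x => (φ k x : ℂ))) := by
    rw [orthonormal_iff_ite]
    intro i j
    rw [hinner _ _ (hc i) (hc j)]
    have := horth i j
    simp only [Complex.conj_ofReal, ← Complex.ofReal_mul]
    rw [intervalIntegral.integral_ofReal, this]
    split_ifs <;> simp
  have hb := hv.sum_inner_products_le ((hmem g hg).toLp g) (s := Finset.range n)
  have hk : ∀ k, inner ℂ ((hmem _ (hc k)).toLp (fun x => (φ k x : ℂ))) ((hmem g hg).toLp g)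
      = ∫ x in (0:ℝ)..Real.pi, (φ k x : ℂ) * g x := by
    intro k
    rw [hinner _ _ (hc k) hg]
    simp only [Complex.conj_ofReal]
  simp only [hk] at hb
  refine hb.trans (le_of_eq ?_)
  rw [← inner_self_eq_norm_sq (𝕜 := ℂ), hinner _ _ hg hg]
  have : ∀ x, (starRingEnd ℂ) (g x) * g x = ((‖g x‖ ^ 2 : ℝ) : ℂ) := by
    intro x
    rw [mul_comm, Complex.mul_conj, Complex.normSq_eq_norm_sq]
  simp only [this]
  rw [intervalIntegral.integral_ofReal]
  simp

lemma int_cos_aux (m : ℤ) : ∫ x in (0:ℝ)..Real.pi, Real.cos (m * x) = if m = 0 then Real.pi else 0 := by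
  split_ifs with h
  · simp [h]
  · have h' : (m:ℝ) ≠ 0 := by exact_mod_cast h
    rw [intervalIntegral.integral_comp_mul_left _ h']
    simp [Real.sin_int_mul_pi]

lemma int_cc (j k : ℕ) : ∫ x in (0:ℝ)..Real.pi, Real.cos (j * x) * Real.cos (k * x)
    = ((if (j:ℤ) - k = 0 then Real.pi else 0) + (if (j:ℤ) + k = 0 then Real.pi else 0)) / 2 := by
  rw [← int_cos_aux, ← int_cos_aux, ← intervalIntegral.integral_add, ← intervalIntegral.integral_div]
  · congr 1; ext x
    push_cast
    rw [sub_mul, add_mul, Real.cos_sub, Real.cos_add]; ring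
  all_goals exact Continuous.intervalIntegrable (by fun_prop) _ _

lemma int_ss (j k : ℕ) : ∫ x in (0:ℝ)..Real.pi, Real.sin (j * x) * Real.sin (k * x)
    = ((if (j:ℤ) - k = 0 then Real.pi else 0) - (if (j:ℤ) + k = 0 then Real.pi else 0)) / 2 := by
  rw [← int_cos_aux, ← int_cos_aux, ← intervalIntegral.integral_sub, ← intervalIntegral.integral_div]
  · congr 1; ext x
    push_cast
    rw [sub_mul, add_mul, Real.cos_sub, Real.cos_add]; ring
  all_goals exact Continuous.intervalIntegrable (by fun_prop) _ _

/-- The cosine family. -/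
noncomputable def cphi (k : ℕ) (x : ℝ) : ℝ :=
  (if k = 0 then Real.sqrt (1 / Real.pi) else Real.sqrt (2 / Real.pi)) * Real.cos (k * x)

/-- The sine family. -/
noncomputable def sphi (k : ℕ) (x : ℝ) : ℝ := Real.sqrt (2 / Real.pi) * Real.sin ((k + 1 : ℕ) * x)

lemma cphi_orth (j k : ℕ) :
    ∫ x in (0:ℝ)..Real.pi, cphi j x * cphi k x = if j = k then 1 else 0 := by
  have hpi := Real.pi_pos
  have h1 := Real.mul_self_sqrt (show 0 ≤ 1 / Real.pi by positivity)
  have h2 := Real.mul_self_sqrt (show 0 ≤ 2 / Real.pi by positivity)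
  have : ∀ x, cphi j x * cphi k x =
    ((if j = 0 then Real.sqrt (1 / Real.pi) else Real.sqrt (2 / Real.pi)) *
     (if k = 0 then Real.sqrt (1 / Real.pi) else Real.sqrt (2 / Real.pi))) *
      (Real.cos (j * x) * Real.cos (k * x)) := by
    intro x; unfold cphi; ring
  simp only [this]
  rw [intervalIntegral.integral_const_mul, int_cc]
  by_cases hjk : j = k
  · subst hjk
    by_cases hj : j = 0
    · subst hj; simp only [if_true, h1]; simp
    · have : ¬ ((j:ℤ) + j = 0) := by omega
      simp only [if_neg hj, if_true, h2, sub_self, if_neg this]; field_simp; ring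
  · have a : ¬ ((j:ℤ) - k = 0) := by omega
    have b : ¬ ((j:ℤ) + k = 0) := by omega
    simp [hjk, a, b]

lemma sphi_orth (j k : ℕ) :
    ∫ x in (0:ℝ)..Real.pi, sphi j x * sphi k x = if j = k then 1 else 0 := by
  have hpi := Real.pi_pos
  have h2 := Real.mul_self_sqrt (show 0 ≤ 2 / Real.pi by positivity)
  have : ∀ x, sphi j x * sphi k x =
    (Real.sqrt (2 / Real.pi) * Real.sqrt (2 / Real.pi)) *
      (Real.sin ((j + 1 : ℕ) * x) * Real.sin ((k + 1 : ℕ) * x)) := by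
    intro x; unfold sphi; ring
  simp only [this]
  rw [intervalIntegral.integral_const_mul, int_ss, h2]
  have b : ¬ (((j + 1 : ℕ):ℤ) + ((k + 1 : ℕ) : ℤ) = 0) := by omega
  rw [if_neg b]
  by_cases hjk : j = k
  · subst hjk
    simp only [if_true, sub_self]; field_simp; ring
  · have a : ¬ (((j + 1 : ℕ):ℤ) - ((k + 1 : ℕ) : ℤ) = 0) := by omega
    rw [if_neg a, if_neg hjk]; simp

open MeasureTheory in
lemma chebCoeff_eq (f : ℝ → ℂ) (k : ℕ) :
    chebCoeff f k = ∫ x in (0:ℝ)..Real.pi, (cphi k x : ℂ) * f (Real.cos x) := by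
  have himg : Real.cos '' Ioo 0 Real.pi = Ioo (-1) 1 := by
    ext t
    constructor
    · rintro ⟨x, hx, rfl⟩
      constructor
      · rw [← Real.cos_pi]; exact Real.cos_lt_cos_of_nonneg_of_le_pi hx.1.le le_rfl hx.2
      · rw [← Real.cos_zero]; exact Real.cos_lt_cos_of_nonneg_of_le_pi le_rfl hx.2.le hx.1
    · intro ht
      refine ⟨Real.arccos t, ⟨Real.arccos_pos.2 ht.2, ?_⟩, Real.cos_arccos ht.1.le ht.2.le⟩
      rw [← Real.arccos_neg_one]
      exact Real.arccos_lt_arccos le_rfl ht.1 ht.2.le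
  have hinj : InjOn Real.cos (Ioo 0 Real.pi) := Real.injOn_cos.mono Ioo_subset_Icc_self
  unfold chebCoeff
  rw [intervalIntegral.integral_of_le (by norm_num), integral_Ioc_eq_integral_Ioo, ← himg,
    integral_image_eq_integral_abs_deriv_smul measurableSet_Ioo
      (fun x _ => (Real.hasDerivAt_cos x).hasDerivWithinAt) hinj,
    intervalIntegral.integral_of_le Real.pi_pos.le, integral_Ioc_eq_integral_Ioo]
  apply setIntegral_congr_fun measurableSet_Ioo
  intro x hx
  have hs : 0 < Real.sin x := Real.sin_pos_of_pos_of_lt_pi hx.1 hx.2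
  have h1 : Real.sqrt (1 - Real.cos x ^ 2) = Real.sin x := by
    rw [← Real.sin_sq, Real.sqrt_sq hs.le]
  have h2 : That k (Real.cos x) = cphi k x := by
    unfold That cphi
    rw [Real.arccos_cos hx.1.le hx.2.le]
    split_ifs with h <;> simp [h]
  have h3 : (Real.sin x : ℂ) ≠ 0 := by
    exact_mod_cast hs.ne'
  simp only [h1, h2, abs_neg, abs_of_pos hs, Complex.real_smul]
  field_simp

lemma le_supNorm (f : ℝ → ℂ) (hf : ContinuousOn f (Icc (-1) 1)) (t : ℝ) (ht : t ∈ Icc (-1:ℝ) 1) :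
    ‖f t‖ ≤ supNorm f := by
  have hb : BddAbove (range fun t : Icc (-1:ℝ) 1 => ‖f t‖) := by
    obtain ⟨C, hC⟩ := isCompact_Icc.exists_bound_of_continuousOn hf
    exact ⟨C, by rintro _ ⟨t, rfl⟩; exact hC t t.2⟩
  exact le_ciSup hb ⟨t, ht⟩

lemma int_sq_le (g : ℝ → ℂ) (hg : Continuous g) (S : ℝ) (h : ∀ x, ‖g x‖ ≤ S) :
    ∫ x in (0:ℝ)..Real.pi, ‖g x‖ ^ 2 ≤ Real.pi * S ^ 2 := by
  have : ∫ x in (0:ℝ)..Real.pi, ‖g x‖ ^ 2 ≤ ∫ x in (0:ℝ)..Real.pi, S ^ 2 := by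
    apply intervalIntegral.integral_mono_on Real.pi_pos.le
    · exact (hg.norm.pow 2).intervalIntegrable _ _
    · simp
    · intro x _
      exact pow_le_pow_left₀ (norm_nonneg _) (h x) 2
  simpa using this

lemma ibp_aux (g g' : ℝ → ℂ) (hg : ∀ x, HasDerivAt g (g' x) x) (hg' : Continuous g') (k : ℕ) :
    ((k + 1 : ℕ) : ℂ) * ∫ x in (0:ℝ)..Real.pi, (cphi (k + 1) x : ℂ) * g x
      = - ∫ x in (0:ℝ)..Real.pi, (sphi k x : ℂ) * g' x := by
  have hgc : Continuous g := continuous_iff_continuousAt.2 fun x => (hg x).continuousAt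
  have hc : Continuous (fun x => (cphi (k + 1) x : ℂ)) := by unfold cphi; fun_prop
  have hs : Continuous (fun x => (sphi k x : ℂ)) := by unfold sphi; fun_prop
  have hd : ∀ x, HasDerivAt (fun x => (sphi k x : ℂ) * g x)
      (((k + 1 : ℕ) : ℂ) * ((cphi (k + 1) x : ℂ) * g x) + (sphi k x : ℂ) * g' x) x := by
    intro x
    have h1 : HasDerivAt (sphi k) (((k + 1 : ℕ) : ℝ) * cphi (k + 1) x) x := by
      have := ((((hasDerivAt_id x).const_mul ((k + 1 : ℕ) : ℝ)).sin).const_mul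
        (Real.sqrt (2 / Real.pi)))
      refine this.congr_deriv ?_
      simp [cphi]; ring
    refine (h1.ofReal_comp.mul (hg x)).congr_deriv ?_
    push_cast; ring
  have := intervalIntegral.integral_eq_sub_of_hasDerivAt (a := 0) (b := Real.pi)
    (fun x _ => hd x) (Continuous.intervalIntegrable (by fun_prop) _ _)
  rw [intervalIntegral.integral_add, intervalIntegral.integral_const_mul] at this
  · have e1 : sphi k Real.pi = 0 := by unfold sphi; rw [Real.sin_nat_mul_pi]; simp
    have e2 : sphi k 0 = 0 := by simp [sphi]
    rw [e1, e2] at this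
    simp only [Complex.ofReal_zero, zero_mul, sub_zero] at this
    exact eq_neg_of_add_eq_zero_left this
  all_goals exact Continuous.intervalIntegrable (by fun_prop) _ _

/-- If `f` is continuously differentiable on `[-1,1]`, then
`‖f‖_{H¹}² = Σ_{k} (1+k)²·|f̂_k|² ≤ 2π·‖f‖_∞² + 2π·‖f'‖_∞²`. -/
theorem h1_norm_le_C1
    (f f' : ℝ → ℂ)
    (hderiv : ∀ t ∈ Icc (-1 : ℝ) 1, HasDerivWithinAt f (f' t) (Icc (-1 : ℝ) 1) t)
    (hcont : ContinuousOn f' (Icc (-1 : ℝ) 1)) :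
    Summable (fun k : ℕ => ((1 : ℝ) + k) ^ 2 * ‖chebCoeff f k‖ ^ 2)
    ∧ (∑' k : ℕ, ((1 : ℝ) + k) ^ 2 * ‖chebCoeff f k‖ ^ 2)
        ≤ 2 * Real.pi * supNorm f ^ 2 + 2 * Real.pi * supNorm f' ^ 2 := by
  have hfc : ContinuousOn f (Icc (-1 : ℝ) 1) := fun t ht => (hderiv t ht).continuousWithinAt
  have hmaps : ∀ x, Real.cos x ∈ Icc (-1 : ℝ) 1 := fun x => Real.cos_mem_Icc x
  set g : ℝ → ℂ := fun x => f (Real.cos x) with hgdef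
  set g' : ℝ → ℂ := fun x => (-Real.sin x) • f' (Real.cos x) with hg'def
  have hg : ∀ x, HasDerivAt g (g' x) x := by
    intro x
    rw [← hasDerivWithinAt_univ]
    exact (hderiv _ (hmaps x)).scomp x (Real.hasDerivAt_cos x).hasDerivWithinAt
      (fun y _ => hmaps y)
  have hgc : Continuous g := hfc.comp_continuous Real.continuous_cos hmaps
  have hg'c : Continuous g' :=
    Real.continuous_sin.neg.smul (hcont.comp_continuous Real.continuous_cos hmaps)
  have hgb : ∀ x, ‖g x‖ ≤ supNorm f := fun x => le_supNorm f hfc _ (hmaps x)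
  have hg'b : ∀ x, ‖g' x‖ ≤ supNorm f' := by
    intro x
    have h1 := le_supNorm f' hcont _ (hmaps x)
    rw [hg'def]
    simp only [norm_smul, norm_neg, Real.norm_eq_abs]
    have := mul_le_mul_of_nonneg_right (Real.abs_sin_le_one x) (norm_nonneg (f' (Real.cos x)))
    linarith
  have A : ∀ n, ∑ k ∈ Finset.range n, ‖chebCoeff f k‖ ^ 2 ≤ Real.pi * supNorm f ^ 2 := by
    intro n
    simp only [chebCoeff_eq]
    exact (bessel_aux cphi (fun k => by unfold cphi; fun_prop) cphi_orth g hgc n).trans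
      (int_sq_le g hgc _ hgb)
  have B : ∀ n, ∑ k ∈ Finset.range n, ((k + 1 : ℕ) : ℝ) ^ 2 * ‖chebCoeff f (k + 1)‖ ^ 2
      ≤ Real.pi * supNorm f' ^ 2 := by
    intro n
    have e : ∀ k : ℕ, ((k + 1 : ℕ) : ℝ) ^ 2 * ‖chebCoeff f (k + 1)‖ ^ 2
        = ‖∫ x in (0:ℝ)..Real.pi, (sphi k x : ℂ) * g' x‖ ^ 2 := by
      intro k
      rw [← norm_neg (∫ x in (0:ℝ)..Real.pi, (sphi k x : ℂ) * g' x), ← ibp_aux g g' hg hg'c k,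
        norm_mul, mul_pow, Complex.norm_natCast, chebCoeff_eq]
    simp only [e]
    exact (bessel_aux sphi (fun k => by unfold sphi; fun_prop) sphi_orth g' hg'c n).trans
      (int_sq_le g' hg'c _ hg'b)
  have C : ∀ n, ∑ k ∈ Finset.range n, ((1 : ℝ) + k) ^ 2 * ‖chebCoeff f k‖ ^ 2
      ≤ 2 * Real.pi * supNorm f ^ 2 + 2 * Real.pi * supNorm f' ^ 2 := by
    intro n
    have h1 : ∑ k ∈ Finset.range n, (k : ℝ) ^ 2 * ‖chebCoeff f k‖ ^ 2
        ≤ Real.pi * supNorm f' ^ 2 := by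
      cases n with
      | zero => simp; have := Real.pi_pos; positivity
      | succ n => rw [Finset.sum_range_succ']; simpa using B n
    have h2 : ∑ k ∈ Finset.range n, ((1 : ℝ) + k) ^ 2 * ‖chebCoeff f k‖ ^ 2
        ≤ ∑ k ∈ Finset.range n, (2 * ‖chebCoeff f k‖ ^ 2
          + 2 * ((k : ℝ) ^ 2 * ‖chebCoeff f k‖ ^ 2)) := by
      apply Finset.sum_le_sum
      intro k _
      nlinarith [mul_nonneg (sq_nonneg ((k:ℝ) - 1)) (sq_nonneg ‖chebCoeff f k‖)]
    rw [Finset.sum_add_distrib, ← Finset.mul_sum, ← Finset.mul_sum] at h2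
    linarith [A n]
  have hnn : ∀ k : ℕ, 0 ≤ ((1 : ℝ) + k) ^ 2 * ‖chebCoeff f k‖ ^ 2 := fun k => by positivity
  exact ⟨summable_of_sum_range_le hnn C, Real.tsum_le_of_sum_range_le hnn C⟩
end
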